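/- arXiv:2210.01111 — 2 statements merged into one kernel-verified Lean document; each statement's English description precedes it below -/
import Mathlib

section
/- Let X have law N(x, σ²I) and Y have law N(x+δ, σ²I) on ℝ^d, let F₁, …, F_t : ℝ^d → {0,1} be random or deterministic measurable functions, and let k' be a positive integer such that ∑_{i=1}^t F_i(1|w) ≤ k' for all w ∈ ℝ^d. If W = {w ∈ ℝ^d : δᵀw ≥ β} for some β ∈ ℝ and (1/k') ∑_{i=1}^t Pr(F_i(X) = 1) ≤ Pr(X ∈ W), then (1/k') ∑_{i=1}^t Pr(F_i(Y) = 1) ≤ Pr(Y ∈ W). -/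
open MeasureTheory ProbabilityTheory

/-- Isotropic Gaussian measure `N(m, σ²I)` on `ℝ^d`, as a product of 1-D Gaussians. -/
noncomputable def gaussPi (d : ℕ) (m : Fin d → ℝ) (σ : ℝ) : Measure (Fin d → ℝ) :=
  Measure.pi fun i => gaussianReal (m i) ⟨σ ^ 2, sq_nonneg σ⟩

/-- Euclidean dot product `aᵀb` on `ℝ^d`. -/
noncomputable def dotp (d : ℕ) (a b : Fin d → ℝ) : ℝ := ∑ i, a i * b i

/-- The product of measures with densities has the product of the densities as its density. -/
theorem pi_withDensity_eq {ι : Type*} [Fintype ι] {E : ι → Type*} [∀ i, MeasurableSpace (E i)]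
    (μ : ∀ i, Measure (E i)) [∀ i, IsProbabilityMeasure (μ i)]
    (f : ∀ i, E i → ENNReal) (hf : ∀ i, Measurable (f i))
    [∀ i, SigmaFinite ((μ i).withDensity (f i))] :
    Measure.pi (fun i => (μ i).withDensity (f i)) =
      (Measure.pi μ).withDensity (fun w => ∏ i, f i (w i)) := by
  classical
  refine Measure.pi_eq fun s hs => ?_
  have hind : ∀ w : ∀ i, E i, (Set.univ.pi s).indicator (fun w => ∏ i, f i (w i)) w =
      ∏ i, (s i).indicator (f i) (w i) := by
    intro w
    by_cases hw : w ∈ Set.univ.pi s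
    · rw [Set.indicator_of_mem hw]
      exact Finset.prod_congr rfl fun i _ => (Set.indicator_of_mem (hw i trivial) _).symm
    · rw [Set.indicator_of_notMem hw]
      obtain ⟨i, hi⟩ : ∃ i, w i ∉ s i := by simpa [Set.mem_pi] using hw
      exact (Finset.prod_eq_zero (Finset.mem_univ i) (Set.indicator_of_notMem hi _)).symm
  have hmeas : ∀ i, Measurable ((s i).indicator (f i)) := fun i => (hf i).indicator (hs i)
  rw [withDensity_apply _ (MeasurableSet.univ_pi hs),
    ← lintegral_indicator (MeasurableSet.univ_pi hs), lintegral_congr hind,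
    lintegral_prod_eq_prod_lintegral_of_indepFun Finset.univ
      (fun i (w : ∀ i, E i) => (s i).indicator (f i) (w i))
      (iIndepFun_pi fun i => (hmeas i).aemeasurable)
      (fun i => (hmeas i).comp (measurable_pi_apply i))]
  refine Finset.prod_congr rfl fun i _ => ?_
  rw [withDensity_apply _ (hs i), ← lintegral_indicator (hs i)]
  exact (measurePreserving_eval μ i).lintegral_comp (hmeas i)

/-- Translating a nondegenerate Gaussian amounts to an exponential change of density. -/
theorem gaussianReal_add_eq_withDensity (m a : ℝ) {v : NNReal} (hv : v ≠ 0) :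
    gaussianReal (m + a) v = (gaussianReal m v).withDensity
      (fun y => ENNReal.ofReal (Real.exp (a * y / v - (a * m / v + a ^ 2 / (2 * v))))) := by
  have hv' : (v : ℝ) ≠ 0 := by exact_mod_cast hv
  rw [gaussianReal_of_var_ne_zero _ hv, gaussianReal_of_var_ne_zero _ hv,
    ← withDensity_mul _ (measurable_gaussianPDF m v) (by fun_prop)]
  congr 1
  ext y
  rw [Pi.mul_apply, gaussianPDF, gaussianPDF,
    ← ENNReal.ofReal_mul (gaussianPDFReal_nonneg _ _ _), gaussianPDFReal, gaussianPDFReal,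
    mul_assoc (√(2 * Real.pi * v))⁻¹, ← Real.exp_add]
  congr 3
  field_simp
  ring

theorem gaussPi_eq_pi (d : ℕ) (m : Fin d → ℝ) {σ : ℝ} {v : NNReal} (hv : (v : ℝ) = σ ^ 2) :
    gaussPi d m σ = Measure.pi fun i => gaussianReal (m i) v := by
  obtain rfl : v = ⟨σ ^ 2, sq_nonneg σ⟩ := NNReal.eq hv
  rfl

instance isProbabilityMeasure_gaussPi (d : ℕ) (m : Fin d → ℝ) (σ : ℝ) :
    IsProbabilityMeasure (gaussPi d m σ) := by
  rw [gaussPi_eq_pi d m (Real.coe_toNNReal _ (sq_nonneg σ))]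
  infer_instance

/-- The likelihood ratio of two isotropic Gaussians with the same variance. -/
theorem gaussPi_add_eq_withDensity {d : ℕ} (x δ : Fin d → ℝ) {σ : ℝ} (hσ : 0 < σ) :
    gaussPi d (x + δ) σ = (gaussPi d x σ).withDensity (fun w => ENNReal.ofReal
      (Real.exp (dotp d δ w / σ ^ 2 - ∑ i, (δ i * x i / σ ^ 2 + δ i ^ 2 / (2 * σ ^ 2))))) := by
  obtain ⟨v, hvσ⟩ : ∃ v : NNReal, (v : ℝ) = σ ^ 2 := ⟨_, Real.coe_toNNReal _ (sq_nonneg σ)⟩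
  have hv : v ≠ 0 := by
    rintro rfl
    exact (pow_pos hσ 2).ne hvσ
  have hprod : ∀ w : Fin d → ℝ, ENNReal.ofReal
      (Real.exp (dotp d δ w / σ ^ 2 - ∑ i, (δ i * x i / σ ^ 2 + δ i ^ 2 / (2 * σ ^ 2)))) =
      ∏ i, ENNReal.ofReal
        (Real.exp (δ i * w i / v - (δ i * x i / v + δ i ^ 2 / (2 * v)))) := by
    intro w
    rw [← ENNReal.ofReal_prod_of_nonneg fun i _ => (Real.exp_pos _).le, ← Real.exp_sum,
      Finset.sum_sub_distrib, dotp, Finset.sum_div, hvσ]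
  have heq := fun i => gaussianReal_add_eq_withDensity (x i) (δ i) hv
  have : ∀ i, SigmaFinite ((gaussianReal (x i) v).withDensity
      (fun y => ENNReal.ofReal
        (Real.exp (δ i * y / v - (δ i * x i / v + δ i ^ 2 / (2 * v)))))) := by
    intro i
    rw [← heq i]
    infer_instance
  simp_rw [hprod]
  rw [gaussPi_eq_pi d _ hvσ, gaussPi_eq_pi d _ hvσ, ← pi_withDensity_eq _ (fun i y => ENNReal.ofReal
    (Real.exp (δ i * y / v - (δ i * x i / v + δ i ^ 2 / (2 * v))))) (fun i => by fun_prop)]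
  simp_rw [← heq, Pi.add_apply]

/-- **Neyman–Pearson lemma**: a superlevel set of the likelihood ratio is a most powerful test. -/
theorem integral_le_measureReal_of_withDensity {Ω : Type*} [MeasurableSpace Ω] {μ ν : Measure Ω}
    [IsFiniteMeasure μ] [IsFiniteMeasure ν] {L : Ω → ℝ} (hL : Measurable L) (hL0 : ∀ w, 0 ≤ L w)
    (hν : ν = μ.withDensity (fun w => ENNReal.ofReal (L w)))
    {W : Set Ω} (hW : MeasurableSet W) {c : ℝ} (hc : 0 ≤ c)
    (hcW : ∀ w ∈ W, c ≤ L w) (hcW' : ∀ w ∉ W, L w ≤ c)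
    {G : Ω → ℝ} (hG : Measurable G) (hG01 : ∀ w, G w ∈ Set.Icc (0 : ℝ) 1)
    (h : ∫ w, G w ∂μ ≤ μ.real W) : ∫ w, G w ∂ν ≤ ν.real W := by
  have hint : ∀ (ρ : Measure Ω) [IsFiniteMeasure ρ], Integrable G ρ := fun ρ _ =>
    Integrable.of_bound hG.aestronglyMeasurable 1 <| .of_forall fun w => by
      rw [Real.norm_of_nonneg (hG01 w).1]
      exact (hG01 w).2
  have hind : ∀ (ρ : Measure Ω) [IsFiniteMeasure ρ],
      Integrable (W.indicator (1 : Ω → ℝ)) ρ := fun ρ _ => (integrable_const 1).indicator hW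
  have hdiff : ∀ (ρ : Measure Ω) [IsFiniteMeasure ρ],
      ∫ w, (W.indicator 1 w - G w) ∂ρ = ρ.real W - ∫ w, G w ∂ρ := fun ρ _ => by
    rw [integral_sub (hind ρ) (hint ρ), integral_indicator_one hW]
  have hLm : Measurable fun w => ENNReal.ofReal (L w) := hL.ennreal_ofReal
  have htop : ∀ᵐ w ∂μ, ENNReal.ofReal (L w) < ⊤ := .of_forall fun _ => ENNReal.ofReal_lt_top
  have hLint : Integrable (fun w => L w * (W.indicator 1 w - G w)) μ := by
    have hi := (hind ν).sub (hint ν)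
    rw [hν, integrable_withDensity_iff_integrable_smul' hLm htop] at hi
    simpa [ENNReal.toReal_ofReal (hL0 _)] using hi
  have hνμ : ∫ w, (W.indicator 1 w - G w) ∂ν = ∫ w, L w * (W.indicator 1 w - G w) ∂μ := by
    rw [hν, integral_withDensity_eq_integral_toReal_smul hLm htop]
    simp [ENNReal.toReal_ofReal (hL0 _)]
  have hmono : ∫ w, c * (W.indicator 1 w - G w) ∂μ ≤
      ∫ w, L w * (W.indicator 1 w - G w) ∂μ := by
    refine integral_mono (((hind μ).sub (hint μ)).const_mul c) hLint fun w => ?_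
    by_cases hw : w ∈ W
    · simp only [Set.indicator_of_mem hw, Pi.one_apply]
      exact mul_le_mul_of_nonneg_right (hcW w hw) (sub_nonneg.2 (hG01 w).2)
    · simp only [Set.indicator_of_notMem hw]
      exact mul_le_mul_of_nonpos_right (hcW' w hw) (by linarith [(hG01 w).1])
  rw [integral_const_mul, ← hνμ, hdiff, hdiff] at hmono
  linarith [mul_nonneg hc (sub_nonneg.2 h)]

/-- Neyman–Pearson variant for multiple functions and Gaussians, part (2):
`X ~ N(x, σ²I)`, `Y ~ N(x+δ, σ²I)`, measurable random functions `F₁,…,F_t`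
(represented by `F i = F_i(1|·) : ℝ^d → [0,1]`) with `∑ᵢ F_i(1|w) ≤ k'` everywhere.
If `W = {w | δᵀw ≥ β}` and `(1/k') ∑ᵢ Pr(F_i(X)=1) ≤ Pr(X ∈ W)`, then
`(1/k') ∑ᵢ Pr(F_i(Y)=1) ≤ Pr(Y ∈ W)`. -/
theorem stmt7 {d : ℕ} (x δ : Fin d → ℝ) (σ : ℝ) (hσ : 0 < σ)
    (t : ℕ) (F : Fin t → (Fin d → ℝ) → ℝ)
    (hFm : ∀ i, Measurable (F i)) (hF01 : ∀ i w, F i w ∈ Set.Icc (0 : ℝ) 1)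
    (k' : ℕ) (hk' : 1 ≤ k') (hsum : ∀ w, ∑ i, F i w ≤ (k' : ℝ))
    (β : ℝ) (W : Set (Fin d → ℝ)) (hW : W = {w | β ≤ dotp d δ w})
    (h : (1 / (k' : ℝ)) * ∑ i, ∫ w, F i w ∂(gaussPi d x σ) ≤ ((gaussPi d x σ) W).toReal) :
    (1 / (k' : ℝ)) * ∑ i, ∫ w, F i w ∂(gaussPi d (x + δ) σ) ≤
      ((gaussPi d (x + δ) σ) W).toReal := by
  have hk : (0 : ℝ) < k' := by exact_mod_cast hk'
  have hFint : ∀ m i, Integrable (F i) (gaussPi d m σ) := fun m i =>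
    Integrable.of_bound (hFm i).aestronglyMeasurable 1 <| .of_forall fun w => by
      rw [Real.norm_of_nonneg (hF01 i w).1]
      exact (hF01 i w).2
  have havg : ∀ m, (1 / (k' : ℝ)) * ∑ i, ∫ w, F i w ∂(gaussPi d m σ) =
      ∫ w, (1 / (k' : ℝ)) * ∑ i, F i w ∂(gaussPi d m σ) := fun m => by
    rw [integral_const_mul, integral_finsetSum _ fun i _ => hFint m i]
  have hdot : Measurable (dotp d δ) := by
    unfold dotp
    fun_prop
  set C := ∑ i, (δ i * x i / σ ^ 2 + δ i ^ 2 / (2 * σ ^ 2))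
  rw [havg] at h ⊢
  refine integral_le_measureReal_of_withDensity
    (L := fun w => Real.exp (dotp d δ w / σ ^ 2 - C)) (c := Real.exp (β / σ ^ 2 - C))
    (by fun_prop) (fun w => (Real.exp_pos _).le) (gaussPi_add_eq_withDensity x δ hσ)
    (hW ▸ measurableSet_le measurable_const hdot) (Real.exp_pos _).le ?_ ?_
    (by fun_prop) (fun w => ⟨?_, ?_⟩) h
  · intro w hw
    rw [hW, Set.mem_ofPred_eq] at hw
    gcongr
  · intro w hw
    rw [hW, Set.mem_ofPred_eq, not_le] at hw
    gcongr
  · exact mul_nonneg (by positivity) (Finset.sum_nonneg fun i _ => (hF01 i w).1)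
  · rw [one_div_mul_eq_div]
    exact (div_le_one hk).2 (hsum w)
end

section
/- Let q₁ ≥ q₂ ≥ … ≥ q_d be reals in (0,1) with ∑_{l=1}^{d} q_l < k', let e be an integer with 1 ≤ e ≤ d, set r = d − e + 1, and fix a real t ≥ 0 and a positive integer k'. For an r-element subset S ⊆ {1,…,d}, writing its elements s₁, …, s_r so that q_{s₁} ≥ … ≥ q_{s_r}, define M(S) = max{ Φ(Φ⁻¹(q_{s₁}) − t), max_{u=1,…,r} (k'/u) · Φ(Φ⁻¹((∑_{l=1}^{u} q_{s_l})/k') − t) }. Then for every r-element subset S ⊆ {1,…,d}, M(S) ≥ M({e, e+1, …, d}). -/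
open MeasureTheory ProbabilityTheory

/-- Standard Gaussian CDF `Φ`. -/
noncomputable def Phi (x : ℝ) : ℝ := (gaussianReal 0 1 (Set.Iic x)).toReal

/-- Inverse of the standard Gaussian CDF, `Φ⁻¹` (genuine inverse on `(0,1)` since `Φ` is a
strictly increasing continuous bijection from `ℝ` onto `(0,1)`). -/
noncomputable def PhiInv : ℝ → ℝ := Function.invFun Phi

/-- The quantity `M(S)` associated with an `r`-element subset `S ⊆ {1,…,d}` whose elements,
given by the enumeration `enum : Fin r → Fin d`, are listed so that
`q (enum 0) ≥ q (enum 1) ≥ … ≥ q (enum (r−1))`: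
`M(S) = max{ Φ(Φ⁻¹(q_{s₁}) − t), max_{u=1,…,r} (k'/u)·Φ(Φ⁻¹((∑_{l=1}^{u} q_{s_l})/k') − t) }`. -/
noncomputable def Mval {d : ℕ} (q : Fin d → ℝ) (k' : ℕ) (t : ℝ) {r : ℕ} (hr : 0 < r)
    (enum : Fin r → Fin d) : ℝ :=
  max (Phi (PhiInv (q (enum ⟨0, hr⟩)) - t))
    (Finset.univ.sup' ⟨⟨0, hr⟩, Finset.mem_univ _⟩ fun u : Fin r =>
      (k' : ℝ) / ((u.val : ℝ) + 1) *
        Phi (PhiInv ((∑ l ∈ Finset.univ.filter (fun l : Fin r => l ≤ u), q (enum l)) /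
          (k' : ℝ)) - t))

theorem Phi_eq_cdf : Phi = cdf (gaussianReal 0 1) := by
  funext x
  rw [cdf_eq_real]
  rfl

theorem Phi_mono : Monotone Phi := by
  rw [Phi_eq_cdf]
  exact monotone_cdf _

theorem Phi_continuous : Continuous Phi := by
  rw [Phi_eq_cdf, continuous_iff_continuousAt]
  intro x
  have : NullSingletonClass (gaussianReal 0 1) := nullSingletonClass_gaussianReal one_ne_zero
  have h := (cdf (gaussianReal 0 1)).measure_singleton x
  rw [measure_cdf, measure_singleton] at h
  have h1 := ENNReal.ofReal_eq_zero.1 h.symm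
  have h2 := (monotone_cdf (gaussianReal 0 1)).leftLim_le (le_refl x)
  rw [(monotone_cdf (gaussianReal 0 1)).continuousAt_iff_leftLim_eq_rightLim,
    StieltjesFunction.rightLim_eq]
  linarith

theorem Phi_PhiInv {p : ℝ} (hp : p ∈ Set.Ioo (0 : ℝ) 1) : Phi (PhiInv p) = p := by
  have h0 := tendsto_cdf_atBot (gaussianReal 0 1)
  have h1 := tendsto_cdf_atTop (gaussianReal 0 1)
  rw [← Phi_eq_cdf] at h0 h1
  obtain ⟨a, ha⟩ := (h0.eventually_lt_const hp.1).exists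
  obtain ⟨b, hb⟩ := (h1.eventually_const_lt hp.2).exists
  exact Function.invFun_eq (mem_range_of_exists_le_of_exists_ge Phi_continuous
    ⟨a, ha.le⟩ ⟨b, hb.le⟩)

theorem PhiInv_monotoneOn : MonotoneOn PhiInv (Set.Ioo 0 1) := by
  intro a ha b hb hab
  by_contra! h
  have h' := Phi_mono h.le
  rw [Phi_PhiInv ha, Phi_PhiInv hb] at h'
  obtain rfl := le_antisymm hab h'
  exact lt_irrefl _ h

theorem Phi_nonneg (x : ℝ) : 0 ≤ Phi x := ENNReal.toReal_nonneg

theorem Phi_PhiInv_sub_le {a b : ℝ} (t : ℝ) (ha : 0 < a) (hab : a ≤ b) (hb : b < 1) :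
    Phi (PhiInv a - t) ≤ Phi (PhiInv b - t) :=
  Phi_mono (sub_le_sub_right
    (PhiInv_monotoneOn ⟨ha, hab.trans_lt hb⟩ ⟨ha.trans_le hab, hb⟩ hab) t)

/-- `M` is monotone in the values of `q` along the enumeration. -/
theorem Mval_le_Mval {d : ℕ} {q : Fin d → ℝ} (hq : ∀ i, q i ∈ Set.Ioo (0 : ℝ) 1)
    {k' : ℕ} (hk' : 1 ≤ k') (hsum : ∑ i, q i < (k' : ℝ)) (t : ℝ) {r : ℕ} (hr : 0 < r)
    {f g : Fin r → Fin d} (hg : Function.Injective g) (hfg : ∀ l, q (f l) ≤ q (g l)) :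
    Mval q k' t hr f ≤ Mval q k' t hr g := by
  have hk : (0 : ℝ) < k' := by exact_mod_cast hk'
  refine max_le_max (Phi_PhiInv_sub_le t (hq _).1 (hfg _) (hq _).2)
    (Finset.sup'_mono_fun fun u _ => ?_)
  refine mul_le_mul_of_nonneg_left (Phi_PhiInv_sub_le t ?_ ?_ ?_) (by positivity)
  · exact div_pos (Finset.sum_pos (fun i _ => (hq _).1) ⟨u, by simp⟩) hk
  · gcongr with l _
    exact hfg l
  · rw [div_lt_one hk]
    refine lt_of_le_of_lt ?_ hsum
    rw [← Finset.sum_image (f := q) hg.injOn]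
    exact Finset.sum_le_sum_of_subset_of_nonneg (Finset.subset_univ _)
      fun i _ _ => (hq i).1.le

/-- The last `r - l` values of an injection `Fin r → Fin d` cannot all exceed `d - (r - l)`. -/
theorem exists_le_and_add_le_of_injective {d r : ℕ} {g : Fin r → Fin d}
    (hg : Function.Injective g) (l : Fin r) :
    ∃ m, l ≤ m ∧ (g m : ℕ) + r ≤ d + l := by
  by_contra! h
  have hsub : ((Finset.Ici l).image fun m => (g m : ℕ)) ⊆ Finset.Ico (d + l + 1 - r) d := by
    intro x hx
    obtain ⟨m, hm, rfl⟩ := Finset.mem_image.1 hx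
    have := h m (Finset.mem_Ici.1 hm)
    have := (g m).isLt
    rw [Finset.mem_Ico]
    omega
  have hcard := Finset.card_le_card hsub
  have hinj : Function.Injective fun m => (g m : ℕ) := Fin.val_injective.comp hg
  rw [Finset.card_image_of_injective _ hinj, Fin.card_Ici, Nat.card_Ico] at hcard
  have hrd : r ≤ d := by simpa using Fintype.card_le_of_injective g hg
  have := l.isLt
  omega

/-- Among all `r`-element subsets `S` of `{1,…,d}` (with `r = d − e + 1`, `1 ≤ e ≤ d`,
`q₁ ≥ … ≥ q_d` in `(0,1)`, `∑ q < k'`, `t ≥ 0`), the quantity `M(S)` is minimized by the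
tail set `{e, e+1, …, d}`: `M(S) ≥ M({e,…,d})` for every such `S` (where the elements of
`S` are enumerated so that their `q`-values are in descending order, and `{e,…,d}` is
enumerated by increasing index, which is descending in `q` since `q` is sorted). -/
theorem stmt15 (d : ℕ) (q : Fin d → ℝ)
    (hmono : ∀ i j : Fin d, i ≤ j → q j ≤ q i)
    (hq : ∀ i, q i ∈ Set.Ioo (0 : ℝ) 1)
    (k' : ℕ) (hk' : 1 ≤ k') (hsum : ∑ i, q i < (k' : ℝ))
    (e : ℕ) (he1 : 1 ≤ e) (hed : e ≤ d)
    (r : ℕ) (hrdef : r = d - e + 1) (hr : 0 < r)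
    (t : ℝ) (ht : 0 ≤ t)
    (S : Finset (Fin d)) (hS : S.card = r)
    (enum : Fin r → Fin d) (henum_inj : Function.Injective enum)
    (henum_mem : ∀ l, enum l ∈ S)
    (henum_sorted : ∀ l₁ l₂ : Fin r, l₁ ≤ l₂ → q (enum l₂) ≤ q (enum l₁)) :
    Mval q k' t hr (fun l : Fin r => ⟨e - 1 + l.val, by have := l.isLt; omega⟩) ≤
      Mval q k' t hr enum := by
  refine Mval_le_Mval hq hk' hsum t hr henum_inj fun l => ?_
  obtain ⟨m, hlm, hm⟩ := exists_le_and_add_le_of_injective henum_inj l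
  refine (hmono (enum m) _ ?_).trans (henum_sorted l m hlm)
  rw [Fin.le_def]
  dsimp only
  omega
end
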